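/- Let L = U^3 ⊕ E8^2 and define I_nik by (v,u,u',e,e') ↦ (v,u,u',-e',-e). Then the fixed sublattice L^{I_nik=1} is isomorphic to U^3 ⊕ E8(2) and the anti-fixed sublattice L^{I_nik=-1} is isomorphic to E8(2). -/

import Mathlib

noncomputable section

/-- The hyperbolic plane lattice `U`, as `ℤ²`. -/
abbrev ULat := Fin 2 → ℤ
/-- The (negative definite) `E8` lattice, as `ℤ⁸`. -/
abbrev E8Lat := Fin 8 → ℤ

/-- Gram matrix of the hyperbolic plane `U`. -/
def Ugram : Matrix (Fin 2) (Fin 2) ℤ := !![0,1;1,0]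

/-- Gram matrix of the negative definite `E8` lattice (negative of the E8 Cartan matrix,
in Bourbaki labeling). -/
def E8gram : Matrix (Fin 8) (Fin 8) ℤ :=
  !![-2,0,1,0,0,0,0,0;
     0,-2,0,1,0,0,0,0;
     1,0,-2,1,0,0,0,0;
     0,1,1,-2,1,0,0,0;
     0,0,0,1,-2,1,0,0;
     0,0,0,0,1,-2,1,0;
     0,0,0,0,0,1,-2,1;
     0,0,0,0,0,0,1,-2]

/-- The bilinear form of `U`. -/
def Ubil : ULat →ₗ[ℤ] ULat →ₗ[ℤ] ℤ := Matrix.toLinearMap₂' ℤ Ugram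
/-- The bilinear form of `E8`. -/
def E8bil : E8Lat →ₗ[ℤ] E8Lat →ₗ[ℤ] ℤ := Matrix.toLinearMap₂' ℤ E8gram

/-- Orthogonal direct sum of two bilinear forms. -/
def prodBil {M N : Type} [AddCommGroup M] [Module ℤ M] [AddCommGroup N] [Module ℤ N]
    (bM : M →ₗ[ℤ] M →ₗ[ℤ] ℤ) (bN : N →ₗ[ℤ] N →ₗ[ℤ] ℤ) :
    (M × N) →ₗ[ℤ] (M × N) →ₗ[ℤ] ℤ :=
  LinearMap.mk₂ ℤ (fun x y => bM x.1 y.1 + bN x.2 y.2)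
    (fun a b c => by simp [map_add]; ring)
    (fun r a b => by simp; ring)
    (fun a b c => by simp [map_add]; ring)
    (fun r a b => by simp; ring)

/-- Two (ℤ-)lattices with forms (valued in `R`) are isometric. -/
def IsometricForms {R M N : Type} [AddCommGroup M] [Module ℤ M] [AddCommGroup N] [Module ℤ N]
    (bM : M → M → R) (bN : N → N → R) : Prop :=
  ∃ e : M ≃ₗ[ℤ] N, ∀ x y, bN (e x) (e y) = bM x y

/-- The K3 lattice `L = U ⊕ U ⊕ U ⊕ E8 ⊕ E8`. -/
abbrev K3Lat := ULat × ULat × ULat × E8Lat × E8Lat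

/-- The bilinear form of the K3 lattice. -/
def K3bil : K3Lat →ₗ[ℤ] K3Lat →ₗ[ℤ] ℤ :=
  prodBil Ubil (prodBil Ubil (prodBil Ubil (prodBil E8bil E8bil)))

/-- The Nikulin involution `(v,u,u',e,e') ↦ (v,u,u',-e',-e)` on the K3 lattice. -/
def Inik : K3Lat →ₗ[ℤ] K3Lat where
  toFun p := (p.1, p.2.1, p.2.2.1, -p.2.2.2.2, -p.2.2.2.1)
  map_add' a b := by simp [Prod.ext_iff, neg_add, add_comm]
  map_smul' c a := by simp [Prod.ext_iff]

/-- The fixed sublattice `L^{I=1}` of an involution. -/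
def fixedLat {M : Type} [AddCommGroup M] [Module ℤ M] (f : M →ₗ[ℤ] M) : Submodule ℤ M :=
  LinearMap.ker (f - LinearMap.id)

/-- The anti-fixed sublattice `L^{I=-1}` of an involution. -/
def antifixedLat {M : Type} [AddCommGroup M] [Module ℤ M] (f : M →ₗ[ℤ] M) : Submodule ℤ M :=
  LinearMap.ker (f + LinearMap.id)

theorem mem_fixed_iff (p : K3Lat) : p ∈ fixedLat Inik ↔ p.2.2.2.2 = -p.2.2.2.1 := by
  obtain ⟨a, b, c, d, e⟩ := p
  simp only [fixedLat, LinearMap.mem_ker, LinearMap.sub_apply, LinearMap.id_apply, sub_eq_zero]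
  simp only [Inik, LinearMap.coe_mk, AddHom.coe_mk, Prod.mk.injEq, true_and]
  constructor
  · rintro ⟨_, h⟩
    exact h.symm
  · rintro rfl
    simp

theorem add_self_zero_iff (a : ULat) : a + a = 0 ↔ a = 0 := by
  constructor
  · intro h
    funext i
    have := congrFun h i
    simp only [Pi.add_apply, Pi.zero_apply] at this ⊢
    omega
  · rintro rfl
    simp

theorem mem_antifixed_iff (p : K3Lat) : p ∈ antifixedLat Inik ↔
    p.1 = 0 ∧ p.2.1 = 0 ∧ p.2.2.1 = 0 ∧ p.2.2.2.2 = p.2.2.2.1 := by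
  obtain ⟨a, b, c, d, e⟩ := p
  simp only [antifixedLat, LinearMap.mem_ker, LinearMap.add_apply, LinearMap.id_apply]
  simp only [Inik, LinearMap.coe_mk, AddHom.coe_mk, Prod.mk_add_mk, Prod.mk_eq_zero,
    add_self_zero_iff]
  constructor
  · rintro ⟨h1, h2, h3, h4, _⟩
    exact ⟨h1, h2, h3, (neg_add_eq_zero.mp h4)⟩
  · rintro ⟨h1, h2, h3, rfl⟩
    exact ⟨h1, h2, h3, by simp, by simp⟩

theorem prodBil_apply {M N : Type} [AddCommGroup M] [Module ℤ M] [AddCommGroup N] [Module ℤ N]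
    (bM : M →ₗ[ℤ] M →ₗ[ℤ] ℤ) (bN : N →ₗ[ℤ] N →ₗ[ℤ] ℤ) (x y : M × N) :
    prodBil bM bN x y = bM x.1 y.1 + bN x.2 y.2 := rfl

/-- The fixed lattice is parametrized by `(v,u,u',e) ↦ (v,u,u',e,-e)`. -/
def fixedEquiv : fixedLat Inik ≃ₗ[ℤ] ULat × ULat × ULat × E8Lat where
  toFun p := (p.1.1, p.1.2.1, p.1.2.2.1, p.1.2.2.2.1)
  map_add' _ _ := rfl
  map_smul' _ _ := rfl
  invFun q := ⟨(q.1, q.2.1, q.2.2.1, q.2.2.2, -q.2.2.2), (mem_fixed_iff _).2 rfl⟩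
  left_inv := by
    rintro ⟨⟨a, b, c, d, e⟩, hp⟩
    have h : e = -d := (mem_fixed_iff _).1 hp
    subst h
    rfl
  right_inv _ := rfl

/-- The anti-fixed lattice is parametrized by `e ↦ (0,0,0,e,e)`. -/
def antifixedEquiv : antifixedLat Inik ≃ₗ[ℤ] E8Lat where
  toFun p := p.1.2.2.2.1
  map_add' _ _ := rfl
  map_smul' _ _ := rfl
  invFun q := ⟨(0, 0, 0, q, q), (mem_antifixed_iff _).2 ⟨rfl, rfl, rfl, rfl⟩⟩
  left_inv := by
    rintro ⟨⟨a, b, c, d, e⟩, hp⟩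
    obtain ⟨h1, h2, h3, h4⟩ := (mem_antifixed_iff _).1 hp
    dsimp only at h1 h2 h3 h4
    subst h1 h2 h3 h4
    rfl
  right_inv _ := rfl

theorem stmt2 :
    IsometricForms (fun x y : fixedLat Inik => K3bil x.1 y.1)
      (fun x y : ULat × ULat × ULat × E8Lat =>
        prodBil Ubil (prodBil Ubil (prodBil Ubil ((2:ℤ) • E8bil))) x y) ∧
    IsometricForms (fun x y : antifixedLat Inik => K3bil x.1 y.1)
      (fun x y : E8Lat => ((2:ℤ) • E8bil) x y) := by
  refine ⟨⟨fixedEquiv, ?_⟩, ⟨antifixedEquiv, ?_⟩⟩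
  · intro x y
    have hx := (mem_fixed_iff _).1 x.2
    have hy := (mem_fixed_iff _).1 y.2
    simp only [K3bil, prodBil_apply, hx, hy, fixedEquiv, LinearEquiv.coe_mk, LinearMap.coe_mk,
      AddHom.coe_mk, LinearMap.smul_apply, map_neg, LinearMap.neg_apply, neg_neg, smul_eq_mul]
    ring
  · intro x y
    obtain ⟨h1, h2, h3, h4⟩ := (mem_antifixed_iff _).1 x.2
    obtain ⟨k1, k2, k3, k4⟩ := (mem_antifixed_iff _).1 y.2
    simp only [K3bil, prodBil_apply, h1, h2, h3, h4, k1, k2, k3, k4, antifixedEquiv,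
      LinearEquiv.coe_mk, LinearMap.coe_mk,
      AddHom.coe_mk, LinearMap.smul_apply, map_zero, LinearMap.zero_apply, smul_eq_mul]
    ring
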